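/- (Nash inequality.) Let (X,d,μ) be a metric measure space, Q a viewpoint at some scale on X, and φ:ℝ₊→ℝ₊ an increasing function. Then X satisfies the Sobolev inequality (S_φ^2) with respect to the gradient |∇·|_{Q,2} (i.e., there are C,C'>0 with ∥f∥_{L²(μ)} ≤ C·φ(C'·μ(supp f))·∥|∇f|_{Q,2}∥_{L²(μ)} for every bounded measurable f with support of finite measure) if and only if there is a constant C<∞ such that every such f satisfies the Nash inequality ∥f∥_{L²(μ)}² ≤ C·φ(C·∥f∥_{L¹(μ)}²/∥f∥_{L²(μ)}²)²·∥|∇f|_{Q,2}∥_{L²(μ)}². -/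

import Mathlib

open MeasureTheory Metric Set Filter ENNReal NNReal

noncomputable section

/-- viewpoint at scale h with density p, constants A and c. -/
structure IsViewpoint {X : Type*} [MetricSpace X] [MeasurableSpace X] (μ : Measure X)
    (h : ℝ) (p : X → X → ℝ) (A c : ℝ) : Prop where
  one_le_A : 1 ≤ A
  c_pos : 0 < c
  nonneg : ∀ x y, 0 ≤ p x y
  meas : Measurable (Function.uncurry p)
  isProb : ∀ x, ∫ y, p x y ∂μ = 1
  supp : ∀ x y, y ∉ closedBall x (A * h) → p x y = 0
  lower : ∀ x, ∀ y ∈ closedBall x h, c ≤ p x y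

/-- L^q gradient associated with a viewpoint density. -/
def vpGrad {X : Type*} [MetricSpace X] [MeasurableSpace X] (μ : Measure X) (p : X → X → ℝ)
    (q : ℝ) (f : X → ℝ) (x : X) : ℝ :=
  (∫ y, |f y - f x| ^ q * p x y ∂μ) ^ (1/q)


/-- The square of the `L²` norm of a real square-integrable function is the integral of its
square. -/
theorem eLpNorm_two_sq_eq_ofReal_integral_sq {X : Type*} [MeasurableSpace X] {μ : Measure X}
    {f : X → ℝ} (hf : MemLp f 2 μ) :
    eLpNorm f 2 μ ^ 2 = ENNReal.ofReal (∫ x, f x ^ 2 ∂μ) := by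
  have h0 : 0 ≤ ∫ x, f x ^ 2 ∂μ := integral_nonneg fun x => sq_nonneg _
  rw [hf.eLpNorm_eq_integral_rpow_norm (by simp) (by simp),
    ← ENNReal.ofReal_pow (by positivity)]
  congr 1
  simp only [ENNReal.toReal_ofNat, Real.rpow_ofNat, Real.norm_eq_abs, sq_abs]
  rw [← Real.rpow_natCast, ← Real.rpow_mul h0]
  norm_num

/-- A bounded measurable function with support of finite measure lies in every `Lᵖ`. -/
theorem memLp_of_bounded_of_measure_support_lt_top {X : Type*} [MeasurableSpace X]
    {μ : Measure X} {f : X → ℝ} (hf : Measurable f) (hb : ∃ M, ∀ x, |f x| ≤ M)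
    (hs : μ (Function.support f) < ⊤) (p : ℝ≥0∞) : MemLp f p μ := by
  obtain ⟨M, hM⟩ := hb
  have : IsFiniteMeasure (μ.restrict (Function.support f)) := ⟨by simpa using hs⟩
  have h1 : MemLp f p (μ.restrict (Function.support f)) :=
    MemLp.of_bound hf.aestronglyMeasurable M (Eventually.of_forall hM)
  have h2 := (memLp_indicator_iff_restrict (measurableSet_support hf)).2 h1
  rwa [Set.indicator_support] at h2

/-- The Cauchy–Schwarz bound `‖f‖₁² ≤ μ(supp f) ‖f‖₂²`. -/
theorem eLpNorm_one_sq_le_measure_support_mul {X : Type*} [MeasurableSpace X]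
    {μ : Measure X} {f : X → ℝ} (hf : Measurable f) :
    eLpNorm f 1 μ ^ 2 ≤ μ (Function.support f) * eLpNorm f 2 μ ^ 2 := by
  have h1 := eLpNorm_le_eLpNorm_mul_rpow_measure_univ (μ := μ.restrict (Function.support f))
    (p := 1) (q := 2) (f := f) (by norm_num) hf.aestronglyMeasurable
  rw [eLpNorm_restrict_eq_of_support_subset Subset.rfl,
    eLpNorm_restrict_eq_of_support_subset Subset.rfl, Measure.restrict_apply_univ] at h1
  refine (pow_le_pow_left' h1 2).trans_eq ?_
  rw [mul_pow, mul_comm, ← ENNReal.rpow_natCast (_ ^ _), ← ENNReal.rpow_mul]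
  norm_num

/-- The `L²`-gradient of a viewpoint is monotone under contractions of the increments. -/
theorem IsViewpoint.vpGrad_two_le {X : Type*} [MetricSpace X] [MeasurableSpace X]
    {μ : Measure X} {h A c : ℝ} {Q : X → X → ℝ} (hQ : IsViewpoint μ h Q A c) {f g : X → ℝ}
    (hf : Measurable f) (hb : ∃ M, ∀ x, |f x| ≤ M)
    (hfg : ∀ x y, |g y - g x| ≤ |f y - f x|) (x : X) :
    vpGrad μ Q 2 g x ≤ vpGrad μ Q 2 f x := by
  obtain ⟨M, hM⟩ := hb
  have hQint : Integrable (fun y => Q x y) μ := by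
    by_contra hn
    exact zero_ne_one ((integral_undef hn).symm.trans (hQ.isProb x))
  refine Real.rpow_le_rpow
    (integral_nonneg fun y => mul_nonneg (by positivity) (hQ.nonneg x y)) ?_ (by norm_num)
  refine integral_mono_of_nonneg
    (Eventually.of_forall fun y => mul_nonneg (by positivity) (hQ.nonneg x y)) ?_
    (Eventually.of_forall fun y => mul_le_mul_of_nonneg_right
      (Real.rpow_le_rpow (abs_nonneg _) (hfg x y) (by norm_num)) (hQ.nonneg x y))
  refine hQint.bdd_mul (c := (2 * M) ^ (2 : ℝ))
    (by simp only [Real.rpow_ofNat]; fun_prop) (Eventually.of_forall fun y => ?_)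
  rw [Real.norm_of_nonneg (by positivity)]
  refine Real.rpow_le_rpow (abs_nonneg _) ?_ (by norm_num)
  linarith [abs_sub (f y) (f x), hM x, hM y]

/-- The soft truncation `(|f| - t)₊` does not increase the increments of `f`. -/
theorem abs_max_abs_sub_sub_le (a b t : ℝ) :
    |max (|a| - t) 0 - max (|b| - t) 0| ≤ |a - b| := by
  refine (abs_max_sub_max_le_abs _ _ _).trans ?_
  rw [sub_sub_sub_cancel_right]
  exact abs_abs_sub_abs_le a b

theorem sq_le_max_abs_sub_sq_add (a : ℝ) {t : ℝ} (ht : 0 ≤ t) :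
    a ^ 2 ≤ max (|a| - t) 0 ^ 2 + 2 * t * |a| := by
  rw [← sq_abs a]
  have ha := abs_nonneg a
  rcases le_total (|a| - t) 0 with hat | hat
  · rw [max_eq_right hat]; nlinarith
  · rw [max_eq_left hat]; nlinarith

/-- Nash's inequality: the Sobolev inequality `(S_φ^2)` with respect to the gradient
`|∇·|_{Q,2}` of a viewpoint `Q` is equivalent to the Nash inequality
`∥f∥₂² ≤ C·φ(C·∥f∥₁²/∥f∥₂²)²·∥|∇f|_{Q,2}∥₂²`. -/
theorem sobolev_iff_nash
    {X : Type*} [MetricSpace X] [MeasurableSpace X] (μ : Measure X)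
    (h A c : ℝ) (hh : 0 < h) (Q : X → X → ℝ) (hQ : IsViewpoint μ h Q A c)
    (φ : ℝ → ℝ) (hφ : Monotone φ) (hφ0 : ∀ t, 0 ≤ φ t) :
    (∃ C > (0:ℝ), ∃ C' > (0:ℝ), ∀ f : X → ℝ, Measurable f → (∃ M, ∀ x, |f x| ≤ M) →
        μ (Function.support f) < ⊤ →
        eLpNorm f 2 μ ≤ ENNReal.ofReal (C * φ (C' * (μ (Function.support f)).toReal)) *
          eLpNorm (fun x => vpGrad μ Q 2 f x) 2 μ) ↔
    (∃ C > (0:ℝ), ∀ f : X → ℝ, Measurable f → (∃ M, ∀ x, |f x| ≤ M) →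
        μ (Function.support f) < ⊤ →
        eLpNorm f 2 μ ^ 2 ≤
          ENNReal.ofReal
            (C * φ (C * ((eLpNorm f 1 μ).toReal ^ 2 / (eLpNorm f 2 μ).toReal ^ 2)) ^ 2) *
            eLpNorm (fun x => vpGrad μ Q 2 f x) 2 μ ^ 2) := by
  constructor
  · rintro ⟨C, hC, C', hC', H⟩
    refine ⟨max (2 * C ^ 2) (4 * C'), lt_max_of_lt_left (by positivity), fun f hf hb hs => ?_⟩
    set K := max (2 * C ^ 2) (4 * C')
    have m1 := memLp_of_bounded_of_measure_support_lt_top hf hb hs 1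
    have m2 := memLp_of_bounded_of_measure_support_lt_top hf hb hs 2
    rcases eq_or_ne (eLpNorm f 2 μ) 0 with h0 | h0
    · simp [h0]
    have hb0 : 0 < (eLpNorm f 2 μ).toReal := ENNReal.toReal_pos h0 m2.eLpNorm_ne_top
    have ha0 : 0 < (eLpNorm f 1 μ).toReal := by
      refine ENNReal.toReal_pos (fun h1 => h0 ?_) m1.eLpNorm_ne_top
      rw [eLpNorm_eq_zero_iff hf.aestronglyMeasurable (by norm_num)] at h1 ⊢
      exact h1
    have hbe : (eLpNorm f 2 μ).toReal ^ 2 = ∫ x, f x ^ 2 ∂μ := by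
      rw [← ENNReal.toReal_pow, eLpNorm_two_sq_eq_ofReal_integral_sq m2,
        ENNReal.toReal_ofReal (integral_nonneg fun x => sq_nonneg _)]
    have hae : (eLpNorm f 1 μ).toReal = ∫ x, |f x| ∂μ := by
      rw [eLpNorm_one_eq_lintegral_enorm]
      exact (integral_norm_eq_lintegral_enorm hf.aestronglyMeasurable).symm
    set a := (eLpNorm f 1 μ).toReal
    set b := (eLpNorm f 2 μ).toReal
    set t := b ^ 2 / (4 * a) with ht_def
    have ht : 0 < t := by positivity
    set g : X → ℝ := fun x => max (|f x| - t) 0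
    have hg : Measurable g := by fun_prop
    have hgf : ∀ x, t ≤ |f x| ∨ g x = 0 := fun x =>
      (le_total t |f x|).imp_right fun hx => max_eq_right (by linarith)
    have hgb : ∃ M, ∀ x, |g x| ≤ M := by
      obtain ⟨M, hM⟩ := hb
      refine ⟨M, fun x => ?_⟩
      rw [abs_of_nonneg (le_max_right _ _)]
      exact max_le (by linarith [hM x]) ((abs_nonneg _).trans (hM x))
    have hgs : Function.support g ⊆ {x | t ≤ |f x|} := fun x hx => (hgf x).resolve_right hx
    have hfin : μ {x | t ≤ |f x|} < ⊤ := by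
      refine (measure_mono fun x (hx : t ≤ |f x|) => ?_).trans_lt hs
      exact abs_pos.1 (ht.trans_le hx)
    have hgs' : μ (Function.support g) < ⊤ := (measure_mono hgs).trans_lt hfin
    have m2g := memLp_of_bounded_of_measure_support_lt_top hg hgb hgs' 2
    have markov : C' * (μ (Function.support g)).toReal ≤ K * (a ^ 2 / b ^ 2) := by
      have h1 := mul_meas_ge_le_integral_of_nonneg (μ := μ)
        (Eventually.of_forall fun x => abs_nonneg (f x)) (memLp_one_iff_integrable.1 m1).abs t
      rw [← hae] at h1
      have h2 : (μ (Function.support g)).toReal ≤ μ.real {x | t ≤ |f x|} :=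
        ENNReal.toReal_mono hfin.ne (measure_mono hgs)
      have h3 : (μ (Function.support g)).toReal ≤ 4 * (a ^ 2 / b ^ 2) := by
        have : 4 * (a ^ 2 / b ^ 2) = a / t := by rw [ht_def]; field_simp
        rw [this, le_div_iff₀ ht]
        nlinarith
      calc C' * (μ (Function.support g)).toReal ≤ C' * (4 * (a ^ 2 / b ^ 2)) := by gcongr
        _ = 4 * C' * (a ^ 2 / b ^ 2) := by ring
        _ ≤ K * (a ^ 2 / b ^ 2) := by gcongr; exact le_max_right _ _
    have split : b ^ 2 ≤ 2 * ∫ x, g x ^ 2 ∂μ := by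
      have h1 : ∫ x, f x ^ 2 ∂μ ≤ ∫ x, (g x ^ 2 + 2 * t * |f x|) ∂μ :=
        integral_mono m2.integrable_sq
          (m2g.integrable_sq.add ((memLp_one_iff_integrable.1 m1).abs.const_mul _))
          fun x => sq_le_max_abs_sub_sq_add (f x) ht.le
      rw [integral_add m2g.integrable_sq ((memLp_one_iff_integrable.1 m1).abs.const_mul _),
        integral_const_mul, ← hae, ← hbe] at h1
      have h2 : 2 * t * a = b ^ 2 / 2 := by rw [ht_def]; field_simp; norm_num
      linarith
    have two_mul_ofReal (r : ℝ) : 2 * ENNReal.ofReal r = ENNReal.ofReal (2 * r) := by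
      rw [ENNReal.ofReal_mul (by norm_num), ENNReal.ofReal_ofNat]
    have split' : eLpNorm f 2 μ ^ 2 ≤ 2 * eLpNorm g 2 μ ^ 2 := by
      rw [eLpNorm_two_sq_eq_ofReal_integral_sq m2, eLpNorm_two_sq_eq_ofReal_integral_sq m2g,
        ← hbe, two_mul_ofReal]
      exact ENNReal.ofReal_le_ofReal split
    have grad : eLpNorm (fun x => vpGrad μ Q 2 g x) 2 μ ≤
        eLpNorm (fun x => vpGrad μ Q 2 f x) 2 μ := by
      refine eLpNorm_mono_real fun x => ?_
      have h0 : 0 ≤ vpGrad μ Q 2 g x := Real.rpow_nonneg (integral_nonneg fun y =>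
        mul_nonneg (by positivity) (hQ.nonneg x y)) _
      rw [Real.norm_of_nonneg h0]
      exact hQ.vpGrad_two_le hf hb (fun x y => abs_max_abs_sub_sub_le _ _ _) x
    refine split'.trans ?_
    refine (mul_le_mul_right (pow_le_pow_left' (H g hg hgb hgs') 2) 2).trans ?_
    rw [mul_pow, ← mul_assoc, ← ENNReal.ofReal_pow (mul_nonneg hC.le (hφ0 _)),
      two_mul_ofReal]
    refine mul_le_mul' (ENNReal.ofReal_le_ofReal ?_) (pow_le_pow_left' grad 2)
    calc 2 * (C * φ (C' * (μ (Function.support g)).toReal)) ^ 2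
        = 2 * C ^ 2 * φ (C' * (μ (Function.support g)).toReal) ^ 2 := by ring
      _ ≤ K * φ (K * (a ^ 2 / b ^ 2)) ^ 2 :=
        mul_le_mul (le_max_left _ _) (pow_le_pow_left₀ (hφ0 _) (hφ markov) 2)
          (by positivity) (by positivity)
  · rintro ⟨C, hC, H⟩
    refine ⟨√C, Real.sqrt_pos.2 hC, C, hC, fun f hf hb hs => ?_⟩
    have m2 := memLp_of_bounded_of_measure_support_lt_top hf hb hs 2
    rcases eq_or_ne (eLpNorm f 2 μ) 0 with h0 | h0
    · simp [h0]
    have hb0 : 0 < (eLpNorm f 2 μ).toReal := ENNReal.toReal_pos h0 m2.eLpNorm_ne_top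
    have hle : (eLpNorm f 1 μ).toReal ^ 2 / (eLpNorm f 2 μ).toReal ^ 2 ≤
        (μ (Function.support f)).toReal := by
      rw [div_le_iff₀ (by positivity)]
      have := ENNReal.toReal_mono (ENNReal.mul_ne_top hs.ne (ENNReal.pow_ne_top m2.eLpNorm_ne_top))
        (eLpNorm_one_sq_le_measure_support_mul (μ := μ) hf)
      simpa using this
    rw [← ENNReal.pow_le_pow_left_iff two_ne_zero, mul_pow,
      ← ENNReal.ofReal_pow (mul_nonneg (Real.sqrt_nonneg _) (hφ0 _))]
    refine (H f hf hb hs).trans ?_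
    gcongr
    rw [mul_pow, Real.sq_sqrt hC.le]
    have := pow_le_pow_left₀ (hφ0 _) (hφ (mul_le_mul_of_nonneg_left hle hC.le)) 2
    gcongr
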